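/- Let G = (V,E) be an oriented graph and e ∈ E an edge that is neither a loop nor a coloop. Then: (1) if σ ⊆ E \ {e} is a totally cyclic reorientation of the contraction G_/e, then at least one of σ and σ ∪ {e} is a totally cyclic reorientation of G; (2) if σ ⊆ E \ {e} is a totally cyclic reorientation of the deletion G_∖e, then both σ and σ ∪ {e} are totally cyclic reorientations of G. -/

import Mathlib

namespace ModularFlows

attribute [local instance] Classical.propDecidable

variable {V E : Type}

/-- A directed (simple) cycle, given by its cyclically ordered edges
`c 0, c 1, …, c n`: consecutive edges are head-to-tail compatible (also from
`c n` back to `c 0`) and the start vertices are pairwise distinct. -/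
def IsDirCycle (src tgt : E → V) (n : ℕ) (c : Fin (n + 1) → E) : Prop :=
  Function.Injective (fun i => src (c i)) ∧ ∀ i, tgt (c i) = src (c (i + 1))

/-- An oriented graph is totally cyclic if every edge lies on a directed cycle. -/
def TotallyCyclic (src tgt : E → V) : Prop :=
  ∀ e : E, ∃ (n : ℕ) (c : Fin (n + 1) → E), IsDirCycle src tgt n c ∧ e ∈ Set.range c

/-- An oriented graph is acyclic if it contains no directed cycle. -/
def Acyclic (src tgt : E → V) : Prop :=
  ∀ (n : ℕ) (c : Fin (n + 1) → E), ¬ IsDirCycle src tgt n c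

/-- Source map of the reorientation of the graph along `σ`. -/
noncomputable def rsrc (src tgt : E → V) (σ : Set E) (e : E) : V :=
  if e ∈ σ then tgt e else src e

/-- Target map of the reorientation of the graph along `σ`. -/
noncomputable def rtgt (src tgt : E → V) (σ : Set E) (e : E) : V :=
  if e ∈ σ then src e else tgt e

/-- A `ZMod k`-flow: conservation of flow at every vertex. -/
def IsFlow [Fintype E] (src tgt : E → V) (k : ℕ) (f : E → ZMod k) : Prop :=
  ∀ v : V, (∑ e : E, if tgt e = v then f e else 0) = ∑ e : E, if src e = v then f e else 0

/-- Start vertex of an edge traversed forwards (`true`) or backwards (`false`). -/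
def uSrc (src tgt : E → V) (p : E × Bool) : V := if p.2 then src p.1 else tgt p.1

/-- End vertex of an edge traversed forwards (`true`) or backwards (`false`). -/
def uTgt (src tgt : E → V) (p : E × Bool) : V := if p.2 then tgt p.1 else src p.1

/-- A cycle of the underlying undirected graph, with a chosen traversal
direction: a cyclic sequence of edges, each traversed forwards or backwards,
consecutive ones compatible, visiting pairwise distinct vertices. -/
def IsUCycle (src tgt : E → V) (n : ℕ) (c : Fin (n + 1) → E × Bool) : Prop :=
  Function.Injective (fun i => uSrc src tgt (c i)) ∧
    ∀ i, uTgt src tgt (c i) = uSrc src tgt (c (i + 1))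

/-- A `ZMod l`-tension: the signed sum over every cycle of the underlying
undirected graph (forward edges positively, backward edges negatively) vanishes. -/
def IsTension (src tgt : E → V) (l : ℕ) (t : E → ZMod l) : Prop :=
  ∀ (n : ℕ) (c : Fin (n + 1) → E × Bool), IsUCycle src tgt n c →
    (∑ i : Fin (n + 1), if (c i).2 then t (c i).1 else - t (c i).1) = 0

/-- Adjacency via an edge of `S` (its equivalence closure gives the components
of the spanning subgraph `(V, S)`). -/
def linkRel (src tgt : E → V) (S : Set E) (u v : V) : Prop :=
  ∃ e ∈ S, src e = u ∧ tgt e = v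

/-- Number of (weakly) connected components of the spanning subgraph `(V, S)`. -/
noncomputable def ncompSub (src tgt : E → V) (S : Set E) : ℕ :=
  Nat.card (Quot (linkRel src tgt S))

/-- Number of (weakly) connected components. -/
noncomputable def ncomp (src tgt : E → V) : ℕ :=
  ncompSub src tgt Set.univ

/-- The cyclotomic number `ξ(G) = |E| - |V| + c(G)`. -/
noncomputable def xi [Fintype V] [Fintype E] (src tgt : E → V) : ℤ :=
  (Fintype.card E : ℤ) - (Fintype.card V : ℤ) + (ncomp src tgt : ℤ)

/-- Source map of the contraction `G/S`: vertices are identified along edges of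
`S`, and the edges of `S` are removed. -/
def csrc (src tgt : E → V) (S : Set E) (e : {e : E // e ∉ S}) :
    Quot (linkRel src tgt S) :=
  Quot.mk _ (src e.1)

/-- Target map of the contraction `G/S`. -/
def ctgt (src tgt : E → V) (S : Set E) (e : {e : E // e ∉ S}) :
    Quot (linkRel src tgt S) :=
  Quot.mk _ (tgt e.1)

/-- Source (or target) map of the deletion `G∖S`. -/
def dsrc (src : E → V) (S : Set E) (e : {e : E // e ∉ S}) : V := src e.1

/-- Source (or target) map of the restriction `G[S]`. -/
def ressrc (src : E → V) (S : Set E) (e : {e : E // e ∈ S}) : V := src e.1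

/-- `σ` is a totally cyclic reorientation of the contraction `G/S`. -/
def TCReorContr (src tgt : E → V) (S σ : Set E) : Prop :=
  TotallyCyclic (rsrc (csrc src tgt S) (ctgt src tgt S) {e | e.1 ∈ σ})
                (rtgt (csrc src tgt S) (ctgt src tgt S) {e | e.1 ∈ σ})

/-- `σ` is a totally cyclic reorientation of the deletion `G∖S`. -/
def TCReorDel (src tgt : E → V) (S σ : Set E) : Prop :=
  TotallyCyclic (rsrc (dsrc src S) (dsrc tgt S) {e | e.1 ∈ σ})
                (rtgt (dsrc src S) (dsrc tgt S) {e | e.1 ∈ σ})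

/-- `σ` is an acyclic reorientation of the deletion `G∖S`. -/
def AcyclicReorDel (src tgt : E → V) (S σ : Set E) : Prop :=
  Acyclic (rsrc (dsrc src S) (dsrc tgt S) {e | e.1 ∈ σ})
          (rtgt (dsrc src S) (dsrc tgt S) {e | e.1 ∈ σ})

/-- Entry of the incidence matrix `A_G` at vertex `v` and edge `e`. -/
noncomputable def inc (src tgt : E → V) (v : V) (e : E) : ℤ :=
  (if tgt e = v then 1 else 0) - (if src e = v then 1 else 0)

/-- The number of nowhere-zero `ZMod k`-flows. -/
noncomputable def nzFlowCount [Fintype E] (src tgt : E → V) (k : ℕ) : ℕ :=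
  Nat.card {f : E → ZMod k // IsFlow src tgt k f ∧ ∀ e, f e ≠ 0}

/-- The number of nowhere-zero `ZMod l`-tensions. -/
noncomputable def nzTensionCount (src tgt : E → V) (l : ℕ) : ℕ :=
  Nat.card {t : E → ZMod l // IsTension src tgt l t ∧ ∀ e, t e ≠ 0}

/-- The rank `r(S) = |V| - c(V,S)` of an edge set `S`. -/
noncomputable def rk [Fintype V] (src tgt : E → V) (S : Set E) : ℕ :=
  Fintype.card V - ncompSub src tgt S

/-- The Tutte polynomial `t_G(x,y) = Σ_{S ⊆ E} (x-1)^{r(E)-r(S)} (y-1)^{|S|-r(S)}`. -/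
noncomputable def tutte [Fintype V] [Fintype E] (src tgt : E → V) (x y : ℚ) : ℚ :=
  ∑ S : Finset E,
    (x - 1) ^ (rk src tgt Set.univ - rk src tgt ↑S) * (y - 1) ^ (S.card - rk src tgt ↑S)

/-- `e` is a coloop (bridge): deleting it increases the number of components. -/
def IsColoop (src tgt : E → V) (e : E) : Prop :=
  ncompSub src tgt ({e} : Set E)ᶜ = ncomp src tgt + 1

/-- The number of pairs `(f, σ)` of a `ZMod k`-flow `f` and a totally cyclic
reorientation `σ ⊆ E ∖ supp f` of the contraction `G/supp f`. -/
noncomputable def phiR [Fintype E] (src tgt : E → V) (k : ℕ) : ℕ :=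
  Nat.card {p : (E → ZMod k) × Set E //
    IsFlow src tgt k p.1 ∧ p.2 ⊆ {e | p.1 e = 0} ∧
    TCReorContr src tgt {e | p.1 e ≠ 0} p.2}

/-- The in-degree sequence of the reorientation of the graph along `σ`. -/
noncomputable def indegSeq [Fintype E] (src tgt : E → V) (σ : Set E) (v : V) : ℤ :=
  (Nat.card {e : E // rtgt src tgt σ e = v} : ℤ)

/-- The vector `A_G · e_σ`, where `e_σ` is the characteristic vector of `σ`. -/
noncomputable def AeVec [Fintype E] (src tgt : E → V) (σ : Set E) (v : V) : ℤ :=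
  ∑ e : E, if e ∈ σ then inc src tgt v e else 0

/-- `τ'` is obtained from `τ` by reversing a directed cycle of `_τG`. -/
def cycleReverse (src tgt : E → V) (τ τ' : Set E) : Prop :=
  ∃ (n : ℕ) (c : Fin (n + 1) → E),
    IsDirCycle (rsrc src tgt τ) (rtgt src tgt τ) n c ∧ τ' = symmDiff τ (Set.range c)


/-- One step along a directed edge. -/
def DirStep (s t : E → V) (a b : V) : Prop := ∃ f, s f = a ∧ t f = b

/-- The edge list `l` is a directed walk from `a` to `x`. -/
def IsDirWalk (s t : E → V) (x : V) : V → List E → Prop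
  | a, [] => a = x
  | a, f :: l => s f = a ∧ IsDirWalk s t x (t f) l

theorem IsDirWalk.exists_suffix {s t : E → V} {x : V} {f : E} :
    ∀ {l : List E} {a : V}, IsDirWalk s t x a l → f ∈ l →
      ∃ l', l' <:+ l ∧ IsDirWalk s t x (s f) l'
  | [], _, _, hf => by simp at hf
  | g :: l, a, h, hf => by
    rcases List.mem_cons.1 hf with rfl | hf
    · exact ⟨f :: l, List.suffix_refl _, rfl, h.2⟩
    · obtain ⟨l', hl', hw⟩ := IsDirWalk.exists_suffix h.2 hf
      exact ⟨l', hl'.trans (List.suffix_cons g l), hw⟩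

theorem IsDirWalk.tgt_getElem {s t : E → V} {x : V} :
    ∀ {l : List E} {a : V}, IsDirWalk s t x a l → ∀ (i : ℕ) (hi : i < l.length),
      t l[i] = if h : i + 1 < l.length then s l[i + 1] else x
  | [], _, _, i, hi => by simp at hi
  | [f], _, h, i, hi => by
    obtain rfl : i = 0 := by simpa using hi
    exact (h.2 : t f = x)
  | f :: g :: l, _, h, 0, _ => by simpa using h.2.1.symm
  | f :: g :: l, _, h, i + 1, hi => by
    simpa using IsDirWalk.tgt_getElem h.2 i (by simpa using hi)

theorem exists_simple_walk {s t : E → V} {a x : V}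
    (h : Relation.ReflTransGen (DirStep s t) a x) :
    ∃ l, IsDirWalk s t x a l ∧ (l.map s).Nodup ∧ x ∉ l.map s := by
  induction h using Relation.ReflTransGen.head_induction_on with
  | refl => exact ⟨[], rfl, by simp, by simp⟩
  | @head a b hab _ ih =>
    obtain ⟨f, rfl, rfl⟩ := hab
    obtain ⟨l, hw, hnd, hx⟩ := ih
    by_cases hax : s f = x
    · exact ⟨[], hax, by simp, by simp⟩
    by_cases hmem : s f ∈ l.map s
    · obtain ⟨g, hg, hgf⟩ := List.mem_map.1 hmem
      obtain ⟨l', hl', hw'⟩ := hw.exists_suffix hg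
      exact ⟨l', hgf ▸ hw', hnd.sublist (hl'.sublist.map s),
        fun h => hx ((hl'.sublist.map s).subset h)⟩
    · refine ⟨f :: l, ⟨rfl, hw⟩, List.nodup_cons.2 ⟨hmem, hnd⟩, ?_⟩
      rw [List.map_cons, List.mem_cons, not_or]
      exact ⟨Ne.symm hax, hx⟩

theorem IsDirCycle.reflTransGen {s t : E → V} {n : ℕ} {c : Fin (n + 1) → E}
    (hc : IsDirCycle s t n c) (i : Fin (n + 1)) :
    Relation.ReflTransGen (DirStep s t) (t (c i)) (s (c i)) := by
  have key : ∀ k : ℕ, Relation.ReflTransGen (DirStep s t) (t (c i))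
      (s (c (i + 1 + k • 1))) := by
    intro k
    induction k with
    | zero => rw [zero_nsmul, add_zero, hc.2 i]
    | succ k ih =>
      refine ih.tail ⟨_, rfl, ?_⟩
      rw [hc.2, succ_nsmul, add_assoc (i + 1)]
  have hn : i + 1 + n • 1 = i := by
    have h0 : (n + 1) • (1 : Fin (n + 1)) = 0 := by
      simpa only [Fintype.card_fin] using card_nsmul_eq_zero (x := (1 : Fin (n + 1)))
    rw [add_assoc, ← succ_nsmul', h0, add_zero]
  have h := key n
  rwa [hn] at h

/-- A graph is totally cyclic iff the target of every edge reaches its source. -/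
theorem totallyCyclic_iff {s t : E → V} :
    TotallyCyclic s t ↔ ∀ f, Relation.ReflTransGen (DirStep s t) (t f) (s f) := by
  constructor
  · intro h f
    obtain ⟨n, c, hc, i, rfl⟩ := h f
    exact hc.reflTransGen i
  · intro h f
    obtain ⟨l, hw, hnd, hx⟩ := exists_simple_walk (h f)
    have hw' : IsDirWalk s t (s f) (s f) (f :: l) := ⟨rfl, hw⟩
    have hnd' : ((f :: l).map s).Nodup := List.nodup_cons.2 ⟨hx, hnd⟩
    refine ⟨l.length, fun i => (f :: l)[i.val]'i.isLt, ⟨?_, ?_⟩, 0, rfl⟩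
    · intro i j hij
      have hi : i.val < ((f :: l).map s).length := by simpa using i.is_le
      have hj : j.val < ((f :: l).map s).length := by simpa using j.is_le
      refine Fin.ext ((hnd'.getElem_inj_iff (hi := hi) (hj := hj)).1 ?_)
      simpa only [List.getElem_map] using hij
    · intro i
      have h1 := hw'.tgt_getElem i.val i.isLt
      have h2 := Fin.val_add_one i
      rw [h1]
      split_ifs at h2 with hl
      · simp [hl]
      · have : i.val < l.length := by
          have := i.isLt
          have : i.val ≠ l.length := fun h => hl (Fin.ext h)
          omega
        simp [h2, this]

/-- Reachability is contained in every preorder containing the edges. -/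
theorem reflTransGen_le {s t : E → V} {K : V → V → Prop} (hrefl : ∀ a, K a a)
    (htrans : ∀ a b c, K a b → K b c → K a c) (hstep : ∀ f, K (s f) (t f)) {a b : V}
    (h : Relation.ReflTransGen (DirStep s t) a b) : K a b := by
  induction h with
  | refl => exact hrefl _
  | tail _ hf ih =>
    obtain ⟨f, rfl, rfl⟩ := hf
    exact htrans _ _ _ ih (hstep f)

/-- In a totally cyclic contraction, the target of each edge is related to its source by every
preorder on the original vertices that contains the edges and identifies the ends of the
contracted edges. -/
theorem TCReorContr.rel {src tgt : E → V} {S σ : Set E} (h : TCReorContr src tgt S σ)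
    {K : V → V → Prop} (hrefl : ∀ a, K a a) (htrans : ∀ a b c, K a b → K b c → K a c)
    (hS : ∀ f ∈ S, K (src f) (tgt f) ∧ K (tgt f) (src f))
    (hstep : ∀ f ∉ S, K (rsrc src tgt σ f) (rtgt src tgt σ f)) (f : E) (hf : f ∉ S) :
    K (rtgt src tgt σ f) (rsrc src tgt σ f) := by
  have hl : ∀ a b c, linkRel src tgt S a b → K a c = K b c := by
    rintro _ _ c ⟨g, hg, rfl, rfl⟩
    exact propext ⟨htrans _ _ _ (hS g hg).2, htrans _ _ _ (hS g hg).1⟩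
  have hr : ∀ c a b, linkRel src tgt S a b → K c a = K c b := by
    rintro c _ _ ⟨g, hg, rfl, rfl⟩
    exact propext ⟨fun h => htrans _ _ _ h (hS g hg).1, fun h => htrans _ _ _ h (hS g hg).2⟩
  let K' : Quot (linkRel src tgt S) → Quot (linkRel src tgt S) → Prop :=
    Quot.lift₂ K hr hl
  have hsrc : ∀ g : {g // g ∉ S}, rsrc (csrc src tgt S) (ctgt src tgt S) {e | e.1 ∈ σ} g =
      Quot.mk _ (rsrc src tgt σ g.1) := by
    intro g
    simp only [rsrc, csrc, ctgt, Set.mem_ofPred_eq]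
    split_ifs <;> rfl
  have htgt : ∀ g : {g // g ∉ S}, rtgt (csrc src tgt S) (ctgt src tgt S) {e | e.1 ∈ σ} g =
      Quot.mk _ (rtgt src tgt σ g.1) := by
    intro g
    simp only [rtgt, csrc, ctgt, Set.mem_ofPred_eq]
    split_ifs <;> rfl
  have := reflTransGen_le (K := K') (Quot.ind hrefl)
    (by rintro ⟨a⟩ ⟨b⟩ ⟨c⟩; exact htrans a b c)
    (fun g => by rw [hsrc, htgt]; exact hstep g.1 g.2) (totallyCyclic_iff.1 h ⟨f, hf⟩)
  rwa [hsrc, htgt] at this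

/-- An edge whose ends lie in different components of its deletion is a coloop. -/
theorem isColoop_of_ne [Finite V] {src tgt : E → V} {e : E}
    (h : Quot.mk (linkRel src tgt {e}ᶜ) (src e) ≠ Quot.mk _ (tgt e)) : IsColoop src tgt e := by
  let Q := Quot (linkRel src tgt ({e} : Set E)ᶜ)
  let v : Q := Quot.mk _ (tgt e)
  let toFun : {q : Q // q ≠ v} → Quot (linkRel src tgt Set.univ) := fun q =>
    Quot.lift (fun a => Quot.mk _ a)
      (fun a b ⟨f, _, hf⟩ => Quot.sound ⟨f, Set.mem_univ f, hf⟩) q.1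
  let g : V → {q : Q // q ≠ v} := fun a =>
    if ha : (Quot.mk _ a : Q) = v then ⟨Quot.mk _ (src e), h⟩ else ⟨Quot.mk _ a, ha⟩
  have hg : ∀ a b, linkRel src tgt Set.univ a b → g a = g b := by
    rintro _ _ ⟨f, _, rfl, rfl⟩
    by_cases hf : f = e
    · subst hf
      have h1 : (Quot.mk _ (src f) : Q) ≠ v := h
      have h2 : (Quot.mk _ (tgt f) : Q) = v := rfl
      simp only [g, dif_neg h1, dif_pos h2]
    · have h1 : (Quot.mk _ (src f) : Q) = Quot.mk _ (tgt f) := Quot.sound ⟨f, hf, rfl, rfl⟩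
      simp only [g, h1]
  have hbij : Function.Bijective toFun := by
    refine Function.bijective_iff_has_inverse.2 ⟨Quot.lift g hg, ?_, ?_⟩
    · rintro ⟨⟨a⟩, ha⟩
      exact dif_neg ha
    · rintro ⟨a⟩
      change toFun (g a) = Quot.mk _ a
      by_cases ha : (Quot.mk _ a : Q) = v
      · simp only [g, dif_pos ha]
        have hva : toFun ⟨Quot.mk _ (src e), h⟩ = Quot.mk _ (tgt e) :=
          Quot.sound ⟨e, Set.mem_univ e, rfl, rfl⟩
        rw [hva]
        exact (congrArg (Quot.lift (fun a => Quot.mk (linkRel src tgt Set.univ) a)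
          (fun a b ⟨f, _, hf⟩ => Quot.sound ⟨f, Set.mem_univ f, hf⟩)) ha).symm
      · simp only [g, dif_neg ha]
        rfl
  have hcard : Nat.card Q = Nat.card {q : Q // q ≠ v} + 1 := by
    rw [← Finite.card_option, Nat.card_congr (Equiv.optionSubtypeNe v)]
  unfold IsColoop ncomp ncompSub
  rw [← Nat.card_congr (Equiv.ofBijective toFun hbij)]
  exact hcard

/-- The ends of an edge that is not a coloop are not separated by a vertex set that no other
edge crosses. -/
theorem mem_iff_of_not_isColoop [Finite V] {src tgt : E → V} {e : E} (h : ¬ IsColoop src tgt e)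
    {A : Set V} (σ : Set E)
    (hA : ∀ f, f ≠ e → (rsrc src tgt σ f ∈ A ↔ rtgt src tgt σ f ∈ A)) :
    src e ∈ A ↔ tgt e ∈ A := by
  have hq := not_not.1 (mt isColoop_of_ne h)
  have hlift : ∀ a b, linkRel src tgt ({e} : Set E)ᶜ a b → (a ∈ A) = (b ∈ A) := by
    rintro _ _ ⟨f, hf, rfl, rfl⟩
    have := hA f hf
    unfold rsrc rtgt at this
    split_ifs at this
    · exact propext this.symm
    · exact propext this
  exact iff_of_eq (congrArg (Quot.lift (· ∈ A) hlift) hq)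

/-- Adding an edge between mutually reachable vertices keeps a graph totally cyclic. -/
theorem totallyCyclic_of_rel {s t s' t' : E → V} {e : E}
    (hs : ∀ f, f ≠ e → s' f = s f) (ht : ∀ f, f ≠ e → t' f = t f)
    (he : Relation.ReflTransGen (DirStep s' t') (t' e) (s' e))
    (h : ∀ K : V → V → Prop, (∀ a, K a a) → (∀ a b c, K a b → K b c → K a c) →
      (∀ f, f ≠ e → K (s f) (t f)) → K (s' e) (t' e) → K (t' e) (s' e) →
      ∀ f, f ≠ e → K (t f) (s f)) : TotallyCyclic s' t' := by
  refine totallyCyclic_iff.2 fun f => ?_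
  by_cases hf : f = e
  · exact hf ▸ he
  · rw [hs f hf, ht f hf]
    refine h _ (fun _ => .refl) (fun _ _ _ => .trans) (fun g hg => ?_) (.single ⟨e, rfl, rfl⟩) he f hf
    rw [← hs g hg, ← ht g hg]
    exact .single ⟨g, rfl, rfl⟩

/-- For `e` neither a loop nor a coloop and `σ ⊆ E ∖ {e}`: (1) if `σ` is a
totally cyclic reorientation of the contraction `G/e`, then `σ` or `σ ∪ {e}`
is a totally cyclic reorientation of `G`; (2) if `σ` is a totally cyclic
reorientation of the deletion `G∖e`, then both `σ` and `σ ∪ {e}` are totally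
cyclic reorientations of `G`. -/
theorem tco_lifting {V E : Type} [Fintype V] [Fintype E]
    (src tgt : E → V) (e : E)
    (hloop : src e ≠ tgt e) (hcoloop : ¬ IsColoop src tgt e)
    (σ : Set E) (hσe : e ∉ σ) :
    (TCReorContr src tgt ({e} : Set E) σ →
      TotallyCyclic (rsrc src tgt σ) (rtgt src tgt σ) ∨
      TotallyCyclic (rsrc src tgt (σ ∪ {e})) (rtgt src tgt (σ ∪ {e}))) ∧
    (TCReorDel src tgt ({e} : Set E) σ →
      TotallyCyclic (rsrc src tgt σ) (rtgt src tgt σ) ∧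
      TotallyCyclic (rsrc src tgt (σ ∪ {e})) (rtgt src tgt (σ ∪ {e}))) := by
  set s := rsrc src tgt σ with hs
  set t := rtgt src tgt σ with ht
  have hse : s e = src e := if_neg hσe
  have hte : t e = tgt e := if_neg hσe
  have hse' : rsrc src tgt (σ ∪ {e}) e = tgt e := if_pos (Or.inr rfl)
  have hte' : rtgt src tgt (σ ∪ {e}) e = src e := if_pos (Or.inr rfl)
  have hs' : ∀ f, f ≠ e → rsrc src tgt (σ ∪ {e}) f = s f := fun f hf => by
    simp [hs, rsrc, hf]
  have ht' : ∀ f, f ≠ e → rtgt src tgt (σ ∪ {e}) f = t f := fun f hf => by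
    simp [ht, rtgt, hf]
  let R := Relation.ReflTransGen
    (DirStep (fun f : {f // f ∉ ({e} : Set E)} => s f.1) (fun f => t f.1))
  have hR : ∀ f, f ≠ e → R (s f) (t f) := fun f hf => .single ⟨⟨f, hf⟩, rfl, rfl⟩
  have hmono : ∀ {s' t' : E → V}, (∀ f, f ≠ e → s' f = s f) → (∀ f, f ≠ e → t' f = t f) →
      ∀ {a b}, R a b → Relation.ReflTransGen (DirStep s' t') a b := @fun s' t' hs' ht' _ _ hab =>
    reflTransGen_le (fun _ => .refl) (fun _ _ _ => .trans)
      (fun f : {f // f ∉ ({e} : Set E)} => .single ⟨f.1, hs' f.1 f.2, ht' f.1 f.2⟩) hab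
  constructor
  · intro h
    have key : R (src e) (tgt e) ∨ R (tgt e) (src e) := by
      by_contra! hcon
      obtain ⟨huv, hvu⟩ := hcon
      let K : V → V → Prop := fun a b =>
        R a b ∨ ((R a (src e) ∨ R a (tgt e)) ∧ (R (src e) b ∨ R (tgt e) b))
      have hK := h.rel (K := K) (fun _ => Or.inl .refl)
        (by
          rintro a b c (hab | ⟨hab, hab'⟩) (hbc | ⟨hbc, hbc'⟩)
          · exact Or.inl (hab.trans hbc)
          · exact Or.inr ⟨hbc.imp hab.trans hab.trans, hbc'⟩
          · exact Or.inr ⟨hab, hab'.imp (·.trans hbc) (·.trans hbc)⟩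
          · exact Or.inr ⟨hab, hbc'⟩)
        (by
          rintro f rfl
          exact ⟨Or.inr ⟨Or.inl .refl, Or.inr .refl⟩, Or.inr ⟨Or.inr .refl, Or.inl .refl⟩⟩)
        (fun f hf => Or.inl (hR f hf))
      refine huv ((mem_iff_of_not_isColoop hcoloop σ (A := {x | R (src e) x}) ?_).1 .refl)
      refine fun f hf => ⟨fun hx => hx.trans (hR f hf), fun hx => ?_⟩
      rcases hK f hf with h1 | ⟨h1 | h1, h2 | h2⟩
      · exact hx.trans h1
      · exact h2
      · exact absurd (h2.trans ((hR f hf).trans h1)) hvu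
      · exact h2
      · exact absurd (hx.trans h1) huv
    rcases key with huv | hvu
    · refine Or.inr (totallyCyclic_of_rel hs' ht' ?_ ?_)
      · rw [hse', hte']
        exact hmono hs' ht' huv
      · rw [hse', hte']
        intro K h1 h2 h3 h4 h5
        exact h.rel h1 h2 (by rintro f rfl; exact ⟨h5, h4⟩) h3
    · refine Or.inl (totallyCyclic_of_rel (e := e) (fun _ _ => rfl) (fun _ _ => rfl) ?_ ?_)
      · rw [hse, hte]
        exact hmono (fun _ _ => rfl) (fun _ _ => rfl) hvu
      · rw [hse, hte]
        intro K h1 h2 h3 h4 h5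
        exact h.rel h1 h2 (by rintro f rfl; exact ⟨h4, h5⟩) h3
  · intro h
    have hR' : ∀ f, f ≠ e → R (t f) (s f) := fun f hf => totallyCyclic_iff.1 h ⟨f, hf⟩
    have hclosed : ∀ x f, f ≠ e → (R x (s f) ↔ R x (t f)) := fun x f hf =>
      ⟨(·.trans (hR f hf)), (·.trans (hR' f hf))⟩
    have huv : R (src e) (tgt e) :=
      (mem_iff_of_not_isColoop hcoloop σ (A := {x | R (src e) x}) (hclosed _)).1 .refl
    have hvu : R (tgt e) (src e) :=
      (mem_iff_of_not_isColoop hcoloop σ (A := {x | R (tgt e) x}) (hclosed _)).2 .refl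
    have hrel : ∀ K : V → V → Prop, (∀ a, K a a) → (∀ a b c, K a b → K b c → K a c) →
        (∀ f, f ≠ e → K (s f) (t f)) → ∀ f, f ≠ e → K (t f) (s f) := fun K h1 h2 h3 f hf =>
      reflTransGen_le h1 h2 (fun g : {f // f ∉ ({e} : Set E)} => h3 g.1 g.2) (hR' f hf)
    constructor
    · refine totallyCyclic_of_rel (e := e) (fun _ _ => rfl) (fun _ _ => rfl) ?_
        fun K h1 h2 h3 _ _ => hrel K h1 h2 h3
      rw [hse, hte]
      exact hmono (fun _ _ => rfl) (fun _ _ => rfl) hvu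
    · refine totallyCyclic_of_rel hs' ht' ?_ fun K h1 h2 h3 _ _ => hrel K h1 h2 h3
      rw [hse', hte']
      exact hmono hs' ht' huv

end ModularFlows
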